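/- Let Λ be the uniform distribution (Lebesgue measure) on 𝒬 = (0,1]^d and let r ∈ ℝ. Then the d-dimensional quantization coefficient of order r, c_{r,d}(Λ) = lim_n n^{1/d} e_{n,r}(Λ), exists and is finite; moreover c_{r,d}(Λ) > 0 if and only if r ∈ (−d, +∞). In particular, for r ∈ (−d,0) one has limsup_n n^{1/d} e_{n,r}(Λ) = inf_m m^{1/d} e_{m,r}(Λ) = liminf_n n^{1/d} e_{n,r}(Λ) ∈ (0,∞). -/

import Mathlib

open MeasureTheory Filter Set Metric
open scoped ENNReal NNReal Topology Classical

noncomputable section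

/-- `ℝ^d`, modelled as `Fin d → ℝ` and carrying the maximum norm. -/
abbrev Ed (d : ℕ) := Fin d → ℝ

/-- The half-open unit cube `𝒬 = (0,1]^d`. -/
def Qcube (d : ℕ) : Set (Ed d) := {x | ∀ i, x i ∈ Set.Ioc (0:ℝ) 1}

/-- The half-open dyadic cube of generation `n` with index `k ∈ ℤ^d`. -/
def dyadicCube (d n : ℕ) (k : Fin d → ℤ) : Set (Ed d) :=
  {x | ∀ i, x i ∈ Set.Ioc ((k i : ℝ) / 2 ^ n) (((k i : ℝ) + 1) / 2 ^ n)}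

/-- The family `𝒟_n` of dyadic cubes of generation `n`, forming a partition of `𝒬`. -/
def Dn (d n : ℕ) : Set (Set (Ed d)) :=
  {S | ∃ k : Fin d → ℤ, (∀ i, 0 ≤ k i ∧ k i < 2 ^ n) ∧ S = dyadicCube d n k}

/-- All dyadic cubes `𝒟 = ⋃_n 𝒟_n` (inside `𝒬`). -/
def Ddy (d : ℕ) : Set (Set (Ed d)) := ⋃ n, Dn d n

/-- All dyadic cubes of generation `n` in `ℝ^d`. -/
def DnAll (d n : ℕ) : Set (Set (Ed d)) := {S | ∃ k : Fin d → ℤ, S = dyadicCube d n k}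

/-- Index set enumerating the cubes of `𝒟_n`. -/
def idx (d n : ℕ) : Finset (Fin d → ℤ) :=
  Fintype.piFinset fun _ => Finset.Icc 0 (2 ^ n - 1)

/-- Lebesgue measure restricted to `𝒬`. -/
def Lam (d : ℕ) : Measure (Ed d) := volume.restrict (Qcube d)

/-- `dim_∞(ν) = liminf_n max_{Q ∈ 𝒟_n} log ν(Q) / log 2^{-n}`. -/
def dimInfty (d : ℕ) (ν : Measure (Ed d)) : ℝ :=
  liminf (fun n : ℕ =>
    (⨆ k ∈ idx d n, Real.log (ν (dyadicCube d n k)).toReal) / (-(n : ℝ) * Real.log 2)) atTop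

/-- The set function `J_{ν,r}(Q) = max_{Q' ∈ 𝒟(Q)} ν(Q') Λ(Q')^{r/d}`. -/
def Jf (d : ℕ) (ν : Measure (Ed d)) (r : ℝ) (Q : Set (Ed d)) : ℝ :=
  sSup {v : ℝ | ∃ Q' ∈ Ddy d, Q' ⊆ Q ∧ v = (ν Q').toReal * (Lam d Q').toReal ^ (r / (d:ℝ))}

/-- The `n`-th level `J`-partition sum exponent `τ_{J,n}(q)`. -/
def tauN (d : ℕ) (ν : Measure (Ed d)) (r q : ℝ) (n : ℕ) : ℝ :=
  Real.log (∑ k ∈ (idx d n).filter (fun k => 0 < Jf d ν r (dyadicCube d n k)),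
    Jf d ν r (dyadicCube d n k) ^ q) / ((n : ℝ) * Real.log 2)

/-- The `J`-partition function `τ_{J_{ν,r}}(q)`. -/
def tauJ (d : ℕ) (ν : Measure (Ed d)) (r q : ℝ) : ℝ :=
  limsup (tauN d ν r q) atTop

/-- The critical value `q_r = inf{q > 0 : τ_{J_{ν,r}}(q) < 0}`. -/
def qrCrit (d : ℕ) (ν : Measure (Ed d)) (r : ℝ) : ℝ :=
  sInf {q : ℝ | 0 < q ∧ tauJ d ν r q < 0}

/-- The `n`-th level `L^q`-sum exponent `β_{ν,n}(q)`. -/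
def betaN (d : ℕ) (ν : Measure (Ed d)) (q : ℝ) (n : ℕ) : ℝ :=
  Real.log (∑ k ∈ (idx d n).filter (fun k => 0 < ν (dyadicCube d n k)),
    ((ν (dyadicCube d n k)).toReal) ^ q) / ((n : ℝ) * Real.log 2)

/-- The `L^q`-spectrum `β_ν(q)`. -/
def betaNu (d : ℕ) (ν : Measure (Ed d)) (q : ℝ) : ℝ := limsup (betaN d ν q) atTop

/-- Upper Minkowski (box-counting) dimension of the support of `ν`, computed through the
number of dyadic cubes of positive measure. -/
def dimMUpper (d : ℕ) (ν : Measure (Ed d)) : ℝ :=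
  limsup (fun n : ℕ =>
    Real.log (((idx d n).filter fun k => 0 < ν (dyadicCube d n k)).card) /
      ((n : ℝ) * Real.log 2)) atTop

/-- `log⁺`. -/
def logPlus (x : ℝ) : ℝ := Real.log (max x 1)

/-- `N_{ν,α,r}(n) = card{Q ∈ 𝒟_n : J_{ν,r}(Q) ≥ 2^{-αn}}`. -/
def Ncount (d : ℕ) (ν : Measure (Ed d)) (α r : ℝ) (n : ℕ) : ℕ :=
  ((idx d n).filter fun k => (2:ℝ) ^ (-(α * (n:ℝ))) ≤ Jf d ν r (dyadicCube d n k)).card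

/-- `F̄_{ν,r}(α)`. -/
def FUpperAt (d : ℕ) (ν : Measure (Ed d)) (r α : ℝ) : ℝ :=
  limsup (fun n : ℕ => logPlus (Ncount d ν α r n) / ((n : ℝ) * Real.log 2)) atTop

/-- `F̲_{ν,r}(α)`. -/
def FLowerAt (d : ℕ) (ν : Measure (Ed d)) (r α : ℝ) : ℝ :=
  liminf (fun n : ℕ => logPlus (Ncount d ν α r n) / ((n : ℝ) * Real.log 2)) atTop

/-- The upper optimized coarse multifractal dimension `F̄_r = sup_{α>0} F̄_{ν,r}(α)/α`. -/
def FUpper (d : ℕ) (ν : Measure (Ed d)) (r : ℝ) : ℝ :=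
  sSup {v : ℝ | ∃ α : ℝ, 0 < α ∧ v = FUpperAt d ν r α / α}

/-- The lower optimized coarse multifractal dimension `F̲_r = sup_{α>0} F̲_{ν,r}(α)/α`. -/
def FLower (d : ℕ) (ν : Measure (Ed d)) (r : ℝ) : ℝ :=
  sSup {v : ℝ | ∃ α : ℝ, 0 < α ∧ v = FLowerAt d ν r α / α}

/-- A finite partition of `𝒬` by dyadic cubes. -/
def IsDyadicPartition (d : ℕ) (P : Finset (Set (Ed d))) : Prop :=
  (∀ Q ∈ P, Q ∈ Ddy d) ∧ (P : Set (Set (Ed d))).PairwiseDisjoint id ∧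
    ⋃₀ (P : Set (Set (Ed d))) = Qcube d

/-- `M_{ν,r}(x) = inf{card P : P ∈ Π, max_{Q ∈ P} J_{ν,r}(Q) < 1/x}`. -/
def Mx (d : ℕ) (ν : Measure (Ed d)) (r x : ℝ) : ℕ :=
  sInf {m : ℕ | ∃ P : Finset (Set (Ed d)), IsDyadicPartition d P ∧
    (∀ Q ∈ P, Jf d ν r Q < 1 / x) ∧ P.card = m}

/-- The upper `(ν,r)`-partition entropy `h̄_{ν,r}`. -/
def hUpper (d : ℕ) (ν : Measure (Ed d)) (r : ℝ) : ℝ :=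
  limsup (fun x : ℝ => Real.log (Mx d ν r x) / Real.log x) atTop

/-- The lower `(ν,r)`-partition entropy `h̲_{ν,r}`. -/
def hLowerBase (d : ℕ) (ν : Measure (Ed d)) (r : ℝ) : ℝ :=
  liminf (fun x : ℝ => Real.log (Mx d ν r x) / Real.log x) atTop

/-- `h̲_r = lim_{ε ↓ 0} h̲_{ν,r-ε}`. -/
def hLowerLim (d : ℕ) (ν : Measure (Ed d)) (r : ℝ) : ℝ :=
  limUnder (𝓝[>] (0:ℝ)) (fun ε => hLowerBase d ν (r - ε))

/-- The value `(∫ d(x,A)^r dν)^{1/r}` (resp. `exp ∫ log d(x,A) dν` for `r = 0`) of the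
quantization functional at the codebook `A`; computed in `[0,∞]` so that for `r < 0` a
non-integrable integrand gives the value `0`. -/
def eVal (d : ℕ) (ν : Measure (Ed d)) (A : Finset (Ed d)) (r : ℝ) : ℝ :=
  if r = 0 then Real.exp (∫ x, Real.log (infDist x (A : Set (Ed d))) ∂ν)
  else ((∫⁻ x, ENNReal.ofReal (infDist x (A : Set (Ed d))) ^ r ∂ν) ^ (1 / r)).toReal

/-- The `n`-th quantization error `e_{n,r}(ν)` of order `r`. -/
def qerr (d : ℕ) (ν : Measure (Ed d)) (n : ℕ) (r : ℝ) : ℝ :=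
  sInf {e : ℝ | ∃ A : Finset (Ed d), A.Nonempty ∧ A.card ≤ n ∧ e = eVal d ν A r}

/-- The upper quantization dimension `D̄_r(ν)` (with the convention `1/log 0 = 0`,
realized by `Real.log 0 = 0`). -/
def upperD (d : ℕ) (ν : Measure (Ed d)) (r : ℝ) : ℝ :=
  limsup (fun n : ℕ => Real.log n / (- Real.log (qerr d ν n r))) atTop

/-- The lower quantization dimension `D̲_r(ν)`. -/
def lowerD (d : ℕ) (ν : Measure (Ed d)) (r : ℝ) : ℝ :=
  liminf (fun n : ℕ => Real.log n / (- Real.log (qerr d ν n r))) atTop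

/-- The sequence `n^{1/κ} e_{n,r}(ν)`, viewed in `[0,∞]`. -/
def qcoefSeq (d : ℕ) (ν : Measure (Ed d)) (κ r : ℝ) (n : ℕ) : ℝ≥0∞ :=
  ENNReal.ofReal ((n : ℝ) ^ (1 / κ) * qerr d ν n r)

/-- The `κ`-dimensional quantization coefficient of order `r` exists and equals `c`. -/
def HasQCoef (d : ℕ) (ν : Measure (Ed d)) (κ r : ℝ) (c : ℝ≥0∞) : Prop :=
  Tendsto (qcoefSeq d ν κ r) atTop (𝓝 c)

/-- The `κ`-dimensional quantization coefficient of order `r` (junk value if the limit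
does not exist). -/
def qcoef (d : ℕ) (ν : Measure (Ed d)) (κ r : ℝ) : ℝ≥0∞ :=
  limUnder atTop (qcoefSeq d ν κ r)

/-- `s_h = sup{s > 0 : ‖h‖_{L^s(Λ)} < ∞}`. -/
def sCrit (d : ℕ) (h : Ed d → ℝ≥0∞) : ℝ :=
  sSup {s : ℝ | 0 < s ∧ ∫⁻ x in Qcube d, h x ^ s < ⊤}

/-- `Φ_r(h)`. -/
def Phi (d : ℕ) (r : ℝ) (h : Ed d → ℝ≥0∞) : ℝ :=
  if r ≤ -(d:ℝ) then 0
  else if r = 0 then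
    Real.exp (-(1/(d:ℝ)) * ∫ x in Qcube d, (h x).toReal * Real.log (h x).toReal)
  else ((∫⁻ x in Qcube d, h x ^ ((d:ℝ)/((d:ℝ)+r))) ^ (((d:ℝ)+r)/(d:ℝ) * (1/r))).toReal

/-- `a_ν = sup{q_r : r ∈ (-dim_∞(ν),0)}`, computed in `[0,∞]`. -/
def aNu (d : ℕ) (ν : Measure (Ed d)) : ℝ≥0∞ :=
  ⨆ r ∈ Set.Ioo (-(dimInfty d ν)) (0:ℝ), ENNReal.ofReal (qrCrit d ν r)

/-- `ν` is multifractal-regular at `r`. -/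
def MFregular (d : ℕ) (ν : Measure (Ed d)) (r : ℝ) : Prop :=
  FLower d ν r = FUpper d ν r

/-- `ν` is partition function regular at `r`. -/
def PFregular (d : ℕ) (ν : Measure (Ed d)) (r : ℝ) : Prop :=
  (∃ ε > 0, ∀ q ∈ Set.Ioo (qrCrit d ν r - ε) (qrCrit d ν r),
      Tendsto (tauN d ν r q) atTop (𝓝 (tauJ d ν r q))) ∨
  (Tendsto (tauN d ν r (qrCrit d ν r)) atTop (𝓝 (tauJ d ν r (qrCrit d ν r))) ∧
      DifferentiableAt ℝ (tauJ d ν r) (qrCrit d ν r))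

/-- Distance between two sets. -/
def setDist (d : ℕ) (S T : Set (Ed d)) : ℝ :=
  sInf {v : ℝ | ∃ x ∈ S, ∃ y ∈ T, v = dist x y}

/-- The `2^{-n+1}`-parallel set `B_n(Q̃)` of a dyadic cube `Q̃`. -/
def parSet (d n : ℕ) (Qt : Set (Ed d)) : Set (Ed d) :=
  ⋃ Q ∈ {Q ∈ DnAll d (n-1) | (closure Qt ∩ closure Q).Nonempty}, Q

/-- `V_{n,r}(μ) = sup_A ∫ d(x,A)^r dμ` for `r < 0`, computed in `[0,∞]`. -/
def Vnr (d : ℕ) (μ : Measure (Ed d)) (n : ℕ) (r : ℝ) : ℝ≥0∞ :=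
  ⨆ (A : Finset (Ed d)) (_ : A.Nonempty ∧ A.card ≤ n),
    ∫⁻ x, ENNReal.ofReal (infDist x (A : Set (Ed d))) ^ r ∂μ

lemma measurePreserving_toIocMod_mul (k : ℕ) (hk : k ≠ 0) :
    MeasurePreserving (fun x : ℝ => toIocMod (one_pos : (0 : ℝ) < 1) 0 (k * x))
      (volume.restrict (Ioc 0 1)) (volume.restrict (Ioc 0 1)) := by
  have h1 := UnitAddCircle.measurePreserving_mk 0
  have h2 : MeasurePreserving (fun y : AddCircle (1 : ℝ) => (k : ℤ) • y) volume volume :=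
    Measure.measurePreserving_zsmul volume (by exact_mod_cast hk)
  have h3 := AddCircle.measurePreserving_equivIoc (1 : ℝ) (a := 0)
  have h4 : MeasurePreserving ((↑) : Ioc (0 : ℝ) (0 + 1) → ℝ) _ _ :=
    measurePreserving_subtype_coe (μa := volume) measurableSet_Ioc
  have h := h4.comp (h3.comp (h2.comp h1))
  have e : Ioc (0 : ℝ) 1 = Ioc 0 (0 + 1) := by rw [zero_add]
  rw [e]
  convert! h using 1
  ext x
  have hx : (k : ℤ) • (x : UnitAddCircle) = ((k * x : ℝ) : UnitAddCircle) := by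
    rw [← AddCircle.coe_zsmul]
    simp
  simp only [Function.comp_apply, hx]
  rfl

lemma lam_eq_pi (d : ℕ) : Lam d = Measure.pi fun _ : Fin d => volume.restrict (Ioc (0 : ℝ) 1) := by
  rw [← Measure.restrict_pi_pi, ← volume_pi, Lam]
  congr 1
  ext x
  simp [Qcube]

instance (d : ℕ) : IsProbabilityMeasure (Lam d) := by
  have : IsProbabilityMeasure (volume.restrict (Ioc (0 : ℝ) 1)) := ⟨by simp⟩
  rw [lam_eq_pi]
  infer_instance

/-- The map `x ↦ k x mod 1` on the unit cube, with values in `(0,1]^d`. -/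
def cubeExpand (d k : ℕ) (x : Ed d) : Ed d :=
  fun i => toIocMod (one_pos : (0 : ℝ) < 1) 0 (k * x i)

lemma measurePreserving_cubeExpand (d k : ℕ) (hk : k ≠ 0) :
    MeasurePreserving (cubeExpand d k) (Lam d) (Lam d) := by
  rw [lam_eq_pi]
  exact measurePreserving_pi _ _ fun _ => measurePreserving_toIocMod_mul k hk

/-- Union of the copies of the codebook `A`, shrunk by the factor `k`, in the `k^d` subcubes. -/
def cubeCopies (d k : ℕ) (A : Finset (Ed d)) : Finset (Ed d) :=
  (A ×ˢ Fintype.piFinset fun _ : Fin d => Finset.range k).image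
    fun p i => (p.1 i + (p.2 i : ℝ)) / k

lemma card_cubeCopies_le (d k : ℕ) (A : Finset (Ed d)) :
    (cubeCopies d k A).card ≤ k ^ d * A.card := by
  refine Finset.card_image_le.trans ?_
  simp [Finset.card_product, mul_comm]

lemma cubeCopies_nonempty {d k : ℕ} (hk : k ≠ 0) {A : Finset (Ed d)} (hA : A.Nonempty) :
    (cubeCopies d k A).Nonempty := by
  refine (hA.product ?_).image _
  exact ⟨fun _ => 0, by simpa using fun _ => Nat.pos_of_ne_zero hk⟩

lemma infDist_cubeCopies_le {d k : ℕ} (hk : k ≠ 0) {A : Finset (Ed d)} (hA : A.Nonempty)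
    {x : Ed d} (hx : x ∈ Qcube d) :
    infDist x (cubeCopies d k A : Set (Ed d)) ≤
      infDist (cubeExpand d k x) (A : Set (Ed d)) / k := by
  have hk0 : (0 : ℝ) < k := by exact_mod_cast Nat.pos_of_ne_zero hk
  obtain ⟨a, ha, hda⟩ := A.finite_toSet.isCompact.exists_infDist_eq_dist
    (by exact_mod_cast hA) (cubeExpand d k x)
  rw [hda]
  set j : Fin d → ℕ := fun i => (toIocDiv (one_pos : (0 : ℝ) < 1) 0 (k * x i)).toNat with hj
  have key : ∀ i, j i < k ∧ cubeExpand d k x i = k * x i - j i := by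
    intro i
    have hm := toIocMod_mem_Ioc (one_pos : (0 : ℝ) < 1) 0 (k * x i)
    have he := self_sub_toIocDiv_zsmul (one_pos : (0 : ℝ) < 1) 0 (k * x i)
    set z := toIocDiv (one_pos : (0 : ℝ) < 1) 0 (k * x i) with hz
    simp only [zsmul_eq_mul, mul_one] at he
    rw [← he] at hm
    obtain ⟨hx0, hx1⟩ := hx i
    have hp : 0 < k * x i := by positivity
    have hp' : k * x i ≤ k := by nlinarith
    have hz0 : 0 ≤ z := by
      by_contra hneg
      have : (z : ℝ) ≤ -1 := by exact_mod_cast (by omega : z ≤ -1)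
      linarith [hm.2]
    have hzk : z < k := by
      have : (z : ℝ) < k := by linarith [hm.1]
      exact_mod_cast this
    have hjz : (j i : ℤ) = z := Int.toNat_of_nonneg hz0
    refine ⟨by omega, ?_⟩
    have : (j i : ℝ) = z := by exact_mod_cast hjz
    rw [this]
    exact he.symm
  have hmem : (fun i => (a i + (j i : ℝ)) / k) ∈ (cubeCopies d k A : Set (Ed d)) := by
    simp only [cubeCopies, Finset.coe_image, Set.mem_image]
    exact ⟨(a, j), by simpa using ⟨ha, fun i => (key i).1⟩, rfl⟩
  refine (infDist_le_dist_of_mem hmem).trans ?_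
  rw [dist_pi_le_iff (by positivity)]
  intro i
  have h := dist_le_pi_dist (cubeExpand d k x) a i
  rw [Real.dist_eq, (key i).2] at h
  rw [Real.dist_eq, le_div_iff₀ hk0]
  calc |x i - (a i + j i) / k| * k = |(x i - (a i + j i) / k) * k| := by
        rw [abs_mul, abs_of_pos hk0]
    _ = |k * x i - j i - a i| := by congr 1; field_simp; ring
    _ ≤ _ := h

/-- The power mean `(∫ f^r dμ)^{1/r}` of order `r`. -/
def powMean {α : Type*} [MeasurableSpace α] (μ : Measure α) (r : ℝ) (f : α → ℝ≥0∞) : ℝ≥0∞ :=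
  (∫⁻ x, f x ^ r ∂μ) ^ (1 / r)

lemma ENNReal.rpow_le_rpow_of_nonpos {x y : ℝ≥0∞} {r : ℝ} (hr : r ≤ 0) (h : x ≤ y) :
    y ^ r ≤ x ^ r := by
  rw [← neg_neg r, ENNReal.rpow_neg, ENNReal.rpow_neg x]
  exact ENNReal.inv_le_inv.2 (ENNReal.rpow_le_rpow h (by linarith))

section PowMean

variable {α : Type*} [MeasurableSpace α] {μ : Measure α} {r : ℝ}

lemma powMean_mono (hr : r ≠ 0) {f g : α → ℝ≥0∞} (h : f ≤ᵐ[μ] g) :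
    powMean μ r f ≤ powMean μ r g := by
  rcases hr.lt_or_gt with hr | hr
  · refine ENNReal.rpow_le_rpow_of_nonpos (by simpa using hr.le) (lintegral_mono_ae ?_)
    filter_upwards [h] with x hx using ENNReal.rpow_le_rpow_of_nonpos hr.le hx
  · refine ENNReal.rpow_le_rpow (lintegral_mono_ae ?_) (by positivity)
    filter_upwards [h] with x hx using ENNReal.rpow_le_rpow hx hr.le

lemma powMean_const_mul (hr : r ≠ 0) {c : ℝ≥0∞} (hc : c ≠ 0) (hc' : c ≠ ⊤) (f : α → ℝ≥0∞) :
    powMean μ r (fun x => c * f x) = c * powMean μ r f := by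
  have h {b : ℝ≥0∞} (hb : b ≠ 0) (hb' : b ≠ ⊤) (s : ℝ) (y : ℝ≥0∞) :
      (b * y) ^ s = b ^ s * y ^ s := by
    simp [ENNReal.mul_rpow_eq_ite, hb, hb']
  have hcr : c ^ r ≠ 0 ∧ c ^ r ≠ ⊤ := by simp [ENNReal.rpow_eq_zero_iff, hc, hc']
  unfold powMean
  simp_rw [h hc hc']
  rw [lintegral_const_mul' _ _ hcr.2, h hcr.1 hcr.2, ← ENNReal.rpow_mul, mul_one_div_cancel hr,
    ENNReal.rpow_one]

lemma powMean_const [IsProbabilityMeasure μ] (hr : r ≠ 0) (c : ℝ≥0∞) :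
    powMean μ r (fun _ => c) = c := by
  simp [powMean, ← ENNReal.rpow_mul, hr]

lemma MeasureTheory.MeasurePreserving.powMean_comp {T : α → α} (hT : MeasurePreserving T μ μ)
    {f : α → ℝ≥0∞} (hf : Measurable f) :
    powMean μ r (fun x => f (T x)) = powMean μ r f := by
  unfold powMean
  rw [hT.lintegral_comp (hf.pow_const r)]

end PowMean

lemma ae_infDist_pos {d : ℕ} (hd : 0 < d) {A : Finset (Ed d)} (hA : A.Nonempty) :
    ∀ᵐ x ∂Lam d, 0 < infDist x (A : Set (Ed d)) := by
  have : Nonempty (Fin d) := ⟨⟨0, hd⟩⟩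
  have h : ∀ᵐ x ∂Lam d, x ∉ (A : Set (Ed d)) := by
    refine ae_restrict_of_ae ?_
    rw [ae_iff]
    simpa using A.finite_toSet.measure_zero volume
  filter_upwards [h] with x hx
  exact (A.finite_toSet.isClosed.notMem_iff_infDist_pos (by exact_mod_cast hA)).1 hx

lemma measurableSet_Qcube (d : ℕ) : MeasurableSet (Qcube d) := by
  have : Qcube d = Set.univ.pi fun _ => Ioc (0 : ℝ) 1 := by ext; simp [Qcube]
  rw [this]
  exact MeasurableSet.univ_pi fun _ => measurableSet_Ioc

lemma exists_infDist_le {d : ℕ} {A : Finset (Ed d)} (hA : A.Nonempty) :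
    ∃ M : ℝ, 0 < M ∧ ∀ᵐ x ∂Lam d, infDist x (A : Set (Ed d)) ≤ M := by
  obtain ⟨a, ha⟩ := hA
  refine ⟨1 + ‖a‖, by positivity, ?_⟩
  refine (ae_restrict_mem (measurableSet_Qcube d)).mono fun x hx => ?_
  refine (infDist_le_dist_of_mem (by exact_mod_cast ha)).trans ?_
  refine (dist_eq_norm x a ▸ norm_sub_le x a).trans ?_
  gcongr
  refine (pi_norm_le_iff_of_nonneg zero_le_one).2 fun i => ?_
  rw [Real.norm_eq_abs, abs_of_pos (hx i).1]
  exact (hx i).2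

lemma exists_setLIntegral_ball_norm_rpow_eq {d : ℕ} (hd : 0 < d) {s : ℝ} (hs : -(d : ℝ) < s) :
    ∃ K : ℝ, 0 ≤ K ∧ ∀ δ > 0, ∫⁻ x : Ed d in ball 0 δ, ENNReal.ofReal ‖x‖ ^ s =
      ENNReal.ofReal (K * δ ^ (d + s)) := by
  have : Nonempty (Fin d) := ⟨⟨0, hd⟩⟩
  have hds : 0 < d + s := by linarith
  refine ⟨d * (volume.real (ball (0 : Ed d) 1) / (d + s)), by positivity, fun δ hδ => ?_⟩
  have hpow : ∀ y ∈ Ioi (0 : ℝ), y ^ (d - 1) * y ^ s = y ^ (d + s - 1) := by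
    intro y hy
    rw [← Real.rpow_natCast, ← Real.rpow_add hy]
    congr 1
    push_cast [Nat.cast_sub (show 1 ≤ d from hd)]
    ring
  have hInt : IntegrableOn (fun x : Ed d => ‖x‖ ^ s) (ball 0 δ) volume := by
    rw [integrableOn_fun_norm_addHaar volume (f := fun y => y ^ s)]
    simp only [Module.finrank_fintype_fun_eq_card, Fintype.card_fin, smul_eq_mul]
    rw [integrableOn_congr_fun (fun y hy => hpow y hy.1) measurableSet_Ioo,
      intervalIntegral.integrableOn_Ioo_rpow_iff hδ]
    linarith
  have hval : ∫ x : Ed d in ball 0 δ, ‖x‖ ^ s =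
      d * (volume.real (ball (0 : Ed d) 1) / (d + s)) * δ ^ (d + s) := by
    have h1 : ∫ x : Ed d in ball 0 δ, ‖x‖ ^ s =
        ∫ x : Ed d, (Iio δ).indicator (fun y => y ^ s) ‖x‖ := by
      rw [← integral_indicator measurableSet_ball]
      congr 1
      ext x
      simp [indicator]
    have h2 : ∫ y in Ioi (0 : ℝ), y ^ (d - 1) * (Iio δ).indicator (fun y => y ^ s) y =
        δ ^ (d + s) / (d + s) := by
      calc _ = ∫ y in Ioi (0 : ℝ), (Iio δ).indicator (fun y => y ^ (d + s - 1)) y := by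
            refine setIntegral_congr_fun measurableSet_Ioi fun y hy => ?_
            by_cases hyd : y ∈ Iio δ <;> simp only [hyd, indicator_of_mem, indicator_of_notMem,
              not_false_eq_true, mul_zero]
            exact hpow y hy
        _ = ∫ y in (0 : ℝ)..δ, y ^ (d + s - 1) := by
            rw [setIntegral_indicator measurableSet_Iio, Ioi_inter_Iio,
              ← integral_Ioc_eq_integral_Ioo, intervalIntegral.integral_of_le hδ.le]
        _ = _ := by
            rw [integral_rpow (Or.inl (by linarith))]
            simp [Real.zero_rpow hds.ne']
    rw [h1, integral_fun_norm_addHaar]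
    simp only [Module.finrank_fintype_fun_eq_card, Fintype.card_fin, smul_eq_mul, nsmul_eq_mul]
    rw [h2]
    ring
  rw [← hval, ofReal_integral_eq_lintegral_ofReal hInt
    (Eventually.of_forall fun x => by positivity)]
  have h0 : ∀ᵐ x : Ed d, x ≠ 0 := by simp [ae_iff]
  refine lintegral_congr_ae ((ae_restrict_of_ae h0).mono fun x hx => ?_)
  exact ENNReal.ofReal_rpow_of_pos (norm_pos_iff.2 hx)

lemma exists_lintegral_infDist_rpow_le {d : ℕ} (hd : 0 < d) {s : ℝ} (hs : -(d : ℝ) < s)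
    (hs0 : s < 0) :
    ∃ C : ℝ, 0 < C ∧ ∀ (n : ℕ) (A : Finset (Ed d)), 1 ≤ n → A.Nonempty → A.card ≤ n →
      ∫⁻ x, ENNReal.ofReal (infDist x (A : Set (Ed d))) ^ s ∂Lam d ≤
        ENNReal.ofReal (C * ((n : ℝ) ^ (-(1 / d : ℝ))) ^ s) := by
  obtain ⟨K, hK, hKδ⟩ := exists_setLIntegral_ball_norm_rpow_eq hd hs
  refine ⟨1 + K, by positivity, fun n A hn hA hcard => ?_⟩
  have hn0 : (0 : ℝ) < n := by exact_mod_cast hn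
  set δ : ℝ := (n : ℝ) ^ (-(1 / d : ℝ)) with hδdef
  have hδ : 0 < δ := by positivity
  have hnδ : n * δ ^ (d + s) = δ ^ s := by
    have : δ ^ (d : ℝ) = (n : ℝ)⁻¹ := by
      rw [hδdef, ← Real.rpow_mul hn0.le, neg_mul, one_div,
        inv_mul_cancel₀ (by positivity), Real.rpow_neg_one]
    rw [Real.rpow_add hδ, this]
    field_simp
  have hpt : ∀ x : Ed d, ENNReal.ofReal (infDist x (A : Set (Ed d))) ^ s ≤
      ENNReal.ofReal (δ ^ s) +
        ∑ a ∈ A, (ball (0 : Ed d) δ).indicator (fun y => ENNReal.ofReal ‖y‖ ^ s) (x - a) := by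
    intro x
    obtain ⟨a, ha, hda⟩ := A.finite_toSet.isCompact.exists_infDist_eq_dist
      (by exact_mod_cast hA) x
    rw [hda]
    rcases lt_or_ge (dist x a) δ with h | h
    · refine le_add_left ?_
      refine le_trans ?_ (Finset.single_le_sum (fun _ _ => zero_le) (by exact_mod_cast ha))
      rw [indicator_of_mem (by simpa [dist_eq_norm] using h), dist_eq_norm]
    · refine le_add_right ?_
      rw [← ENNReal.ofReal_rpow_of_pos hδ]
      exact ENNReal.rpow_le_rpow_of_nonpos hs0.le (ENNReal.ofReal_le_ofReal h)
  have hmeas (a : Ed d) : Measurable fun x : Ed d =>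
      (ball (0 : Ed d) δ).indicator (fun y => ENNReal.ofReal ‖y‖ ^ s) (x - a) :=
    Measurable.comp (g := (ball (0 : Ed d) δ).indicator fun y => ENNReal.ofReal ‖y‖ ^ s)
      (Measurable.indicator (by fun_prop) measurableSet_ball) (measurable_id.sub_const a)
  calc _ ≤ ∫⁻ x, (ENNReal.ofReal (δ ^ s) + ∑ a ∈ A,
          (ball (0 : Ed d) δ).indicator (fun y => ENNReal.ofReal ‖y‖ ^ s) (x - a)) ∂Lam d :=
        lintegral_mono hpt
    _ = ENNReal.ofReal (δ ^ s) + ∑ a ∈ A, ∫⁻ x,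
          (ball (0 : Ed d) δ).indicator (fun y => ENNReal.ofReal ‖y‖ ^ s) (x - a) ∂Lam d := by
        rw [lintegral_add_left measurable_const,
          lintegral_finsetSum A fun a _ => hmeas a]
        simp
    _ ≤ ENNReal.ofReal (δ ^ s) + ∑ a ∈ A, ENNReal.ofReal (K * δ ^ (d + s)) := by
        gcongr with a ha
        refine (lintegral_mono' Measure.restrict_le_self le_rfl).trans ?_
        rw [lintegral_sub_right_eq_self _ a, lintegral_indicator measurableSet_ball, hKδ δ hδ]
    _ ≤ ENNReal.ofReal (δ ^ s) + ENNReal.ofReal (n * (K * δ ^ (d + s))) := by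
        rw [Finset.sum_const, nsmul_eq_mul, ENNReal.ofReal_mul hn0.le, ENNReal.ofReal_natCast]
        gcongr
    _ = ENNReal.ofReal ((1 + K) * δ ^ s) := by
        rw [← ENNReal.ofReal_add (by positivity) (by positivity)]
        congr 1
        rw [show n * (K * δ ^ (d + s)) = K * (n * δ ^ (d + s)) by ring, hnδ]
        ring

lemma integrable_log_infDist {d : ℕ} (hd : 0 < d) {A : Finset (Ed d)} (hA : A.Nonempty) :
    Integrable (fun x => Real.log (infDist x (A : Set (Ed d)))) (Lam d) := by
  obtain ⟨M, hM, hMx⟩ := exists_infDist_le hA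
  have hd1 : (1 : ℝ) ≤ d := by exact_mod_cast hd
  obtain ⟨C, hC, hCA⟩ := exists_lintegral_infDist_rpow_le hd (s := -(1 / 2)) (by linarith)
    (by norm_num)
  have hI : Integrable (fun x => infDist x (A : Set (Ed d)) ^ (-(1 / 2) : ℝ)) (Lam d) := by
    refine ⟨((measurable_infDist).pow_const _).aestronglyMeasurable, ?_⟩
    rw [hasFiniteIntegral_iff_ofReal (Eventually.of_forall fun x => by
      have := infDist_nonneg (x := x) (s := (A : Set (Ed d)))
      positivity)]
    refine lt_of_le_of_lt ?_ ((hCA A.card A hA.card_pos hA le_rfl).trans_lt ENNReal.ofReal_lt_top)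
    refine lintegral_mono_ae ((ae_infDist_pos hd hA).mono fun x hx => ?_)
    exact (ENNReal.ofReal_rpow_of_pos hx).ge
  refine ((integrable_const M).add (hI.const_mul 2)).mono'
    (Real.measurable_log.comp measurable_infDist).aestronglyMeasurable ?_
  filter_upwards [ae_infDist_pos hd hA, hMx] with x hx hx'
  rw [Real.norm_eq_abs, abs_le]
  have h1 := Real.log_le_sub_one_of_pos hx
  have h2 := Real.log_le_sub_one_of_pos (Real.rpow_pos_of_pos hx (-(1 / 2)))
  rw [Real.log_rpow hx] at h2
  have h3 : 0 < infDist x (A : Set (Ed d)) ^ (-(1 / 2) : ℝ) := Real.rpow_pos_of_pos hx _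
  simp only [Pi.add_apply]
  constructor <;> linarith

lemma MeasureTheory.ofReal_integral_le_lintegral_ofReal {α : Type*} [MeasurableSpace α]
    {μ : Measure α} {g : α → ℝ} (hg : Integrable g μ) :
    ENNReal.ofReal (∫ x, g x ∂μ) ≤ ∫⁻ x, ENNReal.ofReal (g x) ∂μ := by
  rw [integral_eq_lintegral_pos_part_sub_lintegral_neg_part hg]
  exact (ENNReal.ofReal_le_ofReal (sub_le_self _ ENNReal.toReal_nonneg)).trans
    ENNReal.ofReal_toReal_le

/-- Jensen's inequality for the exponential function. -/
lemma ofReal_exp_integral_log_rpow_le {α : Type*} [MeasurableSpace α] {μ : Measure α}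
    [IsProbabilityMeasure μ] {f : α → ℝ} (hf : ∀ᵐ x ∂μ, 0 < f x)
    (hlog : Integrable (fun x => Real.log (f x)) μ) (s : ℝ) :
    ENNReal.ofReal (Real.exp (∫ x, Real.log (f x) ∂μ) ^ s) ≤
      ∫⁻ x, ENNReal.ofReal (f x) ^ s ∂μ := by
  set L := ∫ x, Real.log (f x) ∂μ with hL
  have hI : Integrable (fun x => s * (Real.log (f x) - L)) μ :=
    (hlog.sub (integrable_const L)).const_mul s
  have hg : Integrable (fun x => Real.exp (s * L) * (1 + s * (Real.log (f x) - L))) μ :=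
    ((integrable_const 1).add hI).const_mul _
  have hval : ∫ x, Real.exp (s * L) * (1 + s * (Real.log (f x) - L)) ∂μ =
      Real.exp L ^ s := by
    rw [integral_const_mul, integral_add (integrable_const 1) hI, integral_const_mul,
      integral_sub hlog (integrable_const L), ← hL]
    simp [← Real.exp_mul, mul_comm]
  rw [← hval]
  refine (ofReal_integral_le_lintegral_ofReal hg).trans (lintegral_mono_ae ?_)
  filter_upwards [hf] with x hx
  rw [ENNReal.ofReal_rpow_of_pos hx]
  refine ENNReal.ofReal_le_ofReal ?_
  calc _ ≤ Real.exp (s * L) * Real.exp (s * (Real.log (f x) - L)) := by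
        gcongr
        linarith [Real.add_one_le_exp (s * (Real.log (f x) - L))]
    _ = f x ^ s := by
        rw [← Real.exp_add, Real.rpow_def_of_pos hx]
        ring_nf

section QuantizationError

variable {d : ℕ} {A : Finset (Ed d)} {r : ℝ}

lemma eVal_zero (A : Finset (Ed d)) :
    eVal d (Lam d) A 0 = Real.exp (∫ x, Real.log (infDist x (A : Set (Ed d))) ∂Lam d) := by
  simp [eVal]

lemma eVal_eq_powMean (hr : r ≠ 0) (A : Finset (Ed d)) :
    eVal d (Lam d) A r =
      (powMean (Lam d) r fun x => ENNReal.ofReal (infDist x (A : Set (Ed d)))).toReal := by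
  simp [eVal, powMean, hr]

lemma powMean_infDist_ne_top (hr : r ≠ 0) (hA : A.Nonempty) :
    (powMean (Lam d) r fun x => ENNReal.ofReal (infDist x (A : Set (Ed d)))) ≠ ⊤ := by
  obtain ⟨M, -, hM⟩ := exists_infDist_le hA
  refine ne_top_of_le_ne_top (ENNReal.ofReal_ne_top (r := M)) ?_
  rw [← powMean_const (μ := Lam d) hr (ENNReal.ofReal M)]
  exact powMean_mono hr (hM.mono fun x hx => ENNReal.ofReal_le_ofReal hx)

lemma eVal_nonneg (A : Finset (Ed d)) : 0 ≤ eVal d (Lam d) A r := by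
  unfold eVal
  split_ifs <;> positivity

lemma eVal_cubeCopies_le (hd : 0 < d) {k : ℕ} (hk : k ≠ 0) (hA : A.Nonempty) :
    eVal d (Lam d) (cubeCopies d k A) r ≤ eVal d (Lam d) A r / k := by
  have hk0 : (0 : ℝ) < k := by exact_mod_cast Nat.pos_of_ne_zero hk
  have hT := measurePreserving_cubeExpand d k hk
  have hle : ∀ᵐ x ∂Lam d, infDist x (cubeCopies d k A : Set (Ed d)) ≤
      infDist (cubeExpand d k x) (A : Set (Ed d)) / k :=
    (ae_restrict_mem (measurableSet_Qcube d)).mono fun x hx => infDist_cubeCopies_le hk hA hx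
  rcases eq_or_ne r 0 with rfl | hr
  · have hlog := integrable_log_infDist hd hA
    rw [eVal_zero, eVal_zero, ← Real.exp_log hk0, ← Real.exp_sub]
    have hae : Integrable (fun x => Real.log (infDist (cubeExpand d k x) (A : Set (Ed d))))
        (Lam d) := (hT.integrable_comp hlog.aestronglyMeasurable).2 hlog
    have hval : ∫ x, Real.log (infDist (cubeExpand d k x) (A : Set (Ed d))) ∂Lam d =
        ∫ x, Real.log (infDist x (A : Set (Ed d))) ∂Lam d := by
      conv_rhs => rw [← hT.map_eq]
      rw [integral_map hT.aemeasurable]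
      rw [hT.map_eq]
      exact hlog.aestronglyMeasurable
    refine Real.exp_le_exp.2 ?_
    calc _ ≤ ∫ x, (Real.log (infDist (cubeExpand d k x) (A : Set (Ed d))) - Real.log k)
          ∂Lam d := by
          refine integral_mono_ae
            (integrable_log_infDist hd (cubeCopies_nonempty hk hA))
            (hae.sub (integrable_const _)) ?_
          filter_upwards [hle, ae_infDist_pos hd (cubeCopies_nonempty hk hA)] with x hx hx0
          have hpos : 0 < infDist (cubeExpand d k x) (A : Set (Ed d)) := by
            have := hx0.trans_le hx
            rwa [div_pos_iff_of_pos_right hk0] at this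
          rw [← Real.log_div hpos.ne' hk0.ne']
          exact Real.log_le_log hx0 hx
      _ = _ := by
          rw [integral_sub hae (integrable_const _), hval]
          simp
  · have hk' : ENNReal.ofReal (k : ℝ)⁻¹ ≠ 0 := by
      rw [← pos_iff_ne_zero, ENNReal.ofReal_pos]
      positivity
    have hmeas : Measurable fun x : Ed d => ENNReal.ofReal (infDist x (A : Set (Ed d))) :=
      measurable_infDist.ennreal_ofReal
    have h : powMean (Lam d) r
        (fun x => ENNReal.ofReal (infDist x (cubeCopies d k A : Set (Ed d)))) ≤
        ENNReal.ofReal (k : ℝ)⁻¹ *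
          powMean (Lam d) r fun x => ENNReal.ofReal (infDist x (A : Set (Ed d))) := by
      rw [← hT.powMean_comp hmeas, ← powMean_const_mul hr hk' ENNReal.ofReal_ne_top]
      refine powMean_mono hr (hle.mono fun x hx => ?_)
      simp only
      rw [← ENNReal.ofReal_mul (by positivity), inv_mul_eq_div]
      exact ENNReal.ofReal_le_ofReal hx
    rw [eVal_eq_powMean hr, eVal_eq_powMean hr]
    refine (ENNReal.toReal_mono (ENNReal.mul_ne_top ENNReal.ofReal_ne_top
      (powMean_infDist_ne_top hr hA)) h).trans_eq ?_
    rw [ENNReal.toReal_mul, ENNReal.toReal_ofReal (by positivity), inv_mul_eq_div]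

lemma exists_le_eVal (hd : 0 < d) (hr : -(d : ℝ) < r) :
    ∃ c : ℝ, 0 < c ∧ ∀ (n : ℕ) (A : Finset (Ed d)), 1 ≤ n → A.Nonempty → A.card ≤ n →
      c * (n : ℝ) ^ (-(1 / d : ℝ)) ≤ eVal d (Lam d) A r := by
  have hd1 : (1 : ℝ) ≤ d := by exact_mod_cast hd
  rcases lt_or_ge r 0 with hr0 | hr0
  · obtain ⟨C, hC, hCA⟩ := exists_lintegral_infDist_rpow_le hd hr hr0
    refine ⟨C ^ (1 / r), by positivity, fun n A hn hA hcard => ?_⟩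
    have hn0 : (0 : ℝ) < n := by exact_mod_cast hn
    have hδ : (0 : ℝ) < (n : ℝ) ^ (-(1 / d : ℝ)) := by positivity
    rw [eVal_eq_powMean hr0.ne,
      ← ENNReal.ofReal_le_iff_le_toReal (powMean_infDist_ne_top hr0.ne hA)]
    have := ENNReal.rpow_le_rpow_of_nonpos (show 1 / r ≤ 0 by simpa using hr0.le)
      (hCA n A hn hA hcard)
    rwa [ENNReal.ofReal_rpow_of_pos (by positivity), Real.mul_rpow hC.le (by positivity),
      ← Real.rpow_mul hδ.le, mul_one_div_cancel hr0.ne, Real.rpow_one] at this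
  · obtain ⟨C, hC, hCA⟩ := exists_lintegral_infDist_rpow_le hd (s := -(1 / 2)) (by linarith)
      (by norm_num)
    refine ⟨C ^ (1 / (-(1 / 2)) : ℝ), by positivity, fun n A hn hA hcard => ?_⟩
    have hn0 : (0 : ℝ) < n := by exact_mod_cast hn
    have hδ : (0 : ℝ) < (n : ℝ) ^ (-(1 / d : ℝ)) := by positivity
    set δ := (n : ℝ) ^ (-(1 / d : ℝ))
    have hJ := ofReal_exp_integral_log_rpow_le (ae_infDist_pos hd hA)
      (integrable_log_infDist hd hA)
    have hG := Real.exp_pos (∫ x, Real.log (infDist x (A : Set (Ed d))) ∂Lam d)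
    set G := Real.exp (∫ x, Real.log (infDist x (A : Set (Ed d))) ∂Lam d) with hGdef
    have h1 : G ^ (-(1 / 2) : ℝ) ≤ C * δ ^ (-(1 / 2) : ℝ) :=
      (ENNReal.ofReal_le_ofReal_iff (by positivity)).1 ((hJ _).trans (hCA n A hn hA hcard))
    have h2 : C ^ (1 / (-(1 / 2)) : ℝ) * δ ≤ G := by
      have := Real.rpow_le_rpow_of_nonpos (by positivity) h1
        (show (1 / (-(1 / 2)) : ℝ) ≤ 0 by norm_num)
      rw [Real.mul_rpow hC.le (by positivity), ← Real.rpow_mul hδ.le, ← Real.rpow_mul hG.le,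
        mul_one_div_cancel (by norm_num), Real.rpow_one, Real.rpow_one] at this
      exact this
    refine h2.trans ?_
    rcases hr0.eq_or_lt with rfl | hr0
    · rw [eVal_zero]
    · rw [eVal_eq_powMean hr0.ne',
        ← ENNReal.ofReal_le_iff_le_toReal (powMean_infDist_ne_top hr0.ne' hA)]
      have := ENNReal.rpow_le_rpow (hJ r) (show 0 ≤ 1 / r by positivity)
      rwa [← ENNReal.ofReal_rpow_of_pos hG, ← ENNReal.rpow_mul, mul_one_div_cancel hr0.ne',
        ENNReal.rpow_one] at this

lemma qerr_le_eVal {n : ℕ} (hA : A.Nonempty) (hcard : A.card ≤ n) :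
    qerr d (Lam d) n r ≤ eVal d (Lam d) A r := by
  refine csInf_le ⟨0, ?_⟩ ⟨A, hA, hcard, rfl⟩
  rintro _ ⟨A, -, -, rfl⟩
  exact eVal_nonneg A

lemma le_qerr {n : ℕ} (hn : 1 ≤ n) {b : ℝ}
    (h : ∀ A : Finset (Ed d), A.Nonempty → A.card ≤ n → b ≤ eVal d (Lam d) A r) :
    b ≤ qerr d (Lam d) n r := by
  refine le_csInf ⟨_, {0}, by simp, by simpa using hn, rfl⟩ ?_
  rintro _ ⟨A, hA, hcard, rfl⟩
  exact h A hA hcard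

lemma qerr_anti {m n : ℕ} (hm : 1 ≤ m) (hmn : m ≤ n) :
    qerr d (Lam d) n r ≤ qerr d (Lam d) m r :=
  le_qerr hm fun _ hA hcard => qerr_le_eVal hA (hcard.trans hmn)

lemma qerr_pow_mul_le (hd : 0 < d) {k m : ℕ} (hk : k ≠ 0) (hm : 1 ≤ m) :
    qerr d (Lam d) (k ^ d * m) r ≤ qerr d (Lam d) m r / k := by
  have hk0 : (0 : ℝ) < k := by exact_mod_cast Nat.pos_of_ne_zero hk
  rw [le_div_iff₀ hk0]
  refine le_qerr hm fun A hA hcard => ?_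
  rw [← le_div_iff₀ hk0]
  refine (qerr_le_eVal (cubeCopies_nonempty hk hA) ?_).trans (eVal_cubeCopies_le hd hk hA)
  exact (card_cubeCopies_le d k A).trans (Nat.mul_le_mul_left _ hcard)

lemma qerr_eq_zero (hd : 0 < d) (hr : r ≤ -(d : ℝ)) {n : ℕ} (hn : 1 ≤ n) :
    qerr d (Lam d) n r = 0 := by
  have : Nonempty (Fin d) := ⟨⟨0, hd⟩⟩
  have hd1 : (1 : ℝ) ≤ d := by exact_mod_cast hd
  have hr0 : r < 0 := by linarith
  refine le_antisymm ?_ (le_qerr hn fun A _ _ => eVal_nonneg A)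
  refine (qerr_le_eVal (A := {fun _ => 1 / 2}) (by simp) (by simpa using hn)).trans_eq ?_
  have hball : ∫⁻ x : Ed d in ball 0 (1 / 2), ENNReal.ofReal ‖x‖ ^ r = ⊤ := by
    by_contra hne
    have hInt : IntegrableOn (fun x : Ed d => ‖x‖ ^ r) (ball 0 (1 / 2)) volume := by
      refine ⟨(measurable_norm.pow_const _).aestronglyMeasurable, ?_⟩
      rw [hasFiniteIntegral_iff_ofReal (Eventually.of_forall fun x => by positivity)]
      refine lt_of_le_of_lt (lintegral_mono_ae ?_) (lt_top_iff_ne_top.2 hne)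
      have h0 : ∀ᵐ x : Ed d, x ≠ 0 := by simp [ae_iff]
      exact (ae_restrict_of_ae h0).mono fun x hx =>
        (ENNReal.ofReal_rpow_of_pos (norm_pos_iff.2 hx)).ge
    rw [integrableOn_fun_norm_addHaar volume (f := fun y => y ^ r)] at hInt
    simp only [Module.finrank_fintype_fun_eq_card, Fintype.card_fin, smul_eq_mul] at hInt
    have hpow : ∀ y ∈ Ioo (0 : ℝ) (1 / 2), y ^ (d - 1) * y ^ r = y ^ (d + r - 1) := by
      intro y hy
      rw [← Real.rpow_natCast, ← Real.rpow_add hy.1]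
      congr 1
      push_cast [Nat.cast_sub (show 1 ≤ d from hd)]
      ring
    rw [integrableOn_congr_fun hpow measurableSet_Ioo,
      intervalIntegral.integrableOn_Ioo_rpow_iff (by norm_num)] at hInt
    linarith
  have htop : ∫⁻ x : Ed d, ENNReal.ofReal (dist x fun _ => 1 / 2) ^ r ∂Lam d = ⊤ := by
    rw [← top_le_iff, ← hball, ← lintegral_indicator measurableSet_ball,
      ← lintegral_sub_right_eq_self _ (fun _ => 1 / 2 : Ed d), Lam,
      ← lintegral_indicator (measurableSet_Qcube d)]
    refine lintegral_mono fun x => ?_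
    by_cases hx : x - (fun _ => 1 / 2) ∈ ball (0 : Ed d) (1 / 2)
    · have hxQ : x ∈ Qcube d := by
        intro i
        rw [mem_ball_zero_iff] at hx
        have := (norm_le_pi_norm _ i).trans_lt hx
        rw [Pi.sub_apply, Real.norm_eq_abs, abs_lt] at this
        constructor <;> linarith
      rw [indicator_of_mem hx, indicator_of_mem hxQ, dist_eq_norm]
    · rw [indicator_of_notMem hx]
      exact zero_le
  rw [eVal, if_neg hr0.ne]
  simp only [Finset.coe_singleton, infDist_singleton]
  rw [htop, ENNReal.top_rpow_of_neg (by simpa using hr0)]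
  simp

lemma qcoefSeq_le_of_pow_mul_le (hd : 0 < d) {k m n : ℕ} (hk : k ≠ 0) (hm : 1 ≤ m)
    (h : k ^ d * m ≤ n) :
    qcoefSeq d (Lam d) d r n ≤
      ENNReal.ofReal (((n : ℝ) / m) ^ (1 / d : ℝ) / k) * qcoefSeq d (Lam d) d r m := by
  have hk0 : (0 : ℝ) < k := by exact_mod_cast Nat.pos_of_ne_zero hk
  have hm0 : (0 : ℝ) < m := by exact_mod_cast hm
  unfold qcoefSeq
  rw [← ENNReal.ofReal_mul (by positivity)]
  refine ENNReal.ofReal_le_ofReal ?_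
  have hle := (qerr_anti (d := d) (r := r)
    (one_le_mul (Nat.one_le_pow _ _ (Nat.pos_of_ne_zero hk)) hm) h).trans
    (qerr_pow_mul_le hd hk hm)
  calc _ ≤ (n : ℝ) ^ (1 / d : ℝ) * (qerr d (Lam d) m r / k) := by gcongr
    _ = _ := by
      rw [Real.div_rpow (by positivity) hm0.le]
      have : (m : ℝ) ^ (1 / d : ℝ) ≠ 0 := by positivity
      field_simp

lemma tendsto_qcoefSeq (hd : 0 < d) (r : ℝ) :
    Tendsto (qcoefSeq d (Lam d) d r) atTop
      (𝓝 (⨅ m ∈ Set.Ici (1 : ℕ), qcoefSeq d (Lam d) d r m)) := by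
  refine tendsto_of_le_liminf_of_limsup_le ?_ ?_
  · refine le_liminf_of_le (by isBoundedDefault) ?_
    filter_upwards [eventually_ge_atTop 1] with n hn using iInf₂_le n hn
  refine le_iInf₂ fun m hm => ?_
  have hm0 : (0 : ℝ) < m := by exact_mod_cast (show 1 ≤ m from hm)
  have hd0 : (0 : ℝ) < d := by exact_mod_cast hd
  set u : ℕ → ℝ := fun n => ((n : ℝ) / m) ^ (1 / d : ℝ) with hu
  have hutop : Tendsto u atTop atTop :=
    (tendsto_rpow_atTop (by positivity)).comp
      (tendsto_natCast_atTop_atTop.atTop_div_const hm0)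
  have hlim : Tendsto (fun n => ENNReal.ofReal (u n / ⌊u n⌋₊) * qcoefSeq d (Lam d) d r m) atTop
      (𝓝 (qcoefSeq d (Lam d) d r m)) := by
    have h1 : Tendsto (fun n => u n / ⌊u n⌋₊) atTop (𝓝 1) := by
      have := (tendsto_nat_floor_div_atTop (R := ℝ)).comp hutop
      simpa [Function.comp_def] using this.inv₀ one_ne_zero
    have h2 := ENNReal.tendsto_ofReal h1
    rw [ENNReal.ofReal_one] at h2
    simpa using ENNReal.Tendsto.mul_const h2 (Or.inl one_ne_zero)
  rw [← hlim.limsup_eq]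
  refine limsup_le_limsup ?_
  filter_upwards [hutop.eventually_ge_atTop 1] with n hn
  have hk : ⌊u n⌋₊ ≠ 0 := (Nat.floor_pos.2 hn).ne'
  refine qcoefSeq_le_of_pow_mul_le hd hk hm ?_
  have h1 : (⌊u n⌋₊ : ℝ) ^ d ≤ n / m := by
    calc (⌊u n⌋₊ : ℝ) ^ d ≤ u n ^ d := by
          gcongr
          exact Nat.floor_le (by positivity)
      _ = n / m := by
          rw [hu]
          simp only
          rw [one_div, Real.rpow_inv_natCast_pow (by positivity) hd.ne']
  rw [le_div_iff₀ hm0] at h1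
  exact_mod_cast h1

lemma iInf_qcoefSeq_pos_iff (hd : 0 < d) (r : ℝ) :
    0 < (⨅ m ∈ Set.Ici (1 : ℕ), qcoefSeq d (Lam d) d r m) ↔ -(d : ℝ) < r := by
  refine ⟨fun h => ?_, fun h => ?_⟩
  · by_contra! hr
    refine (h.trans_le (iInf₂_le 1 (by simp))).ne' ?_
    simp [qcoefSeq, qerr_eq_zero hd hr le_rfl]
  · obtain ⟨c, hc, hcA⟩ := exists_le_eVal hd h
    refine lt_of_lt_of_le (ENNReal.ofReal_pos.2 hc) (le_iInf₂ fun m hm => ?_)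
    have hm0 : (0 : ℝ) < m := by exact_mod_cast (show 1 ≤ m from hm)
    refine ENNReal.ofReal_le_ofReal ?_
    calc c = (m : ℝ) ^ (1 / d : ℝ) * (c * (m : ℝ) ^ (-(1 / d : ℝ))) := by
          rw [Real.rpow_neg hm0.le]
          field_simp
      _ ≤ _ := by
          gcongr
          exact le_qerr hm fun A hA hcard => hcA m A hm hA hcard

end QuantizationError

/-- for the uniform distribution `Λ` on `𝒬 = (0,1]^d` and any `r ∈ ℝ`, the
`d`-dimensional quantization coefficient `c_{r,d}(Λ) = lim_n n^{1/d} e_{n,r}(Λ)` exists and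
is finite, and it is positive iff `r ∈ (-d,∞)`. In particular, for `r ∈ (-d,0)`,
`limsup_n n^{1/d} e_{n,r}(Λ) = inf_{m ≥ 1} m^{1/d} e_{m,r}(Λ) = liminf_n n^{1/d} e_{n,r}(Λ)`
and this common value lies in `(0,∞)`. -/
theorem quantization_coefficient_uniform
    (d : ℕ) (hd : 0 < d) (r : ℝ) :
    (∃ c : ℝ≥0∞, HasQCoef d (Lam d) (d:ℝ) r c ∧ c ≠ ⊤ ∧ (0 < c ↔ -(d:ℝ) < r)) ∧
    (r ∈ Set.Ioo (-(d:ℝ)) 0 →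
      limsup (fun n : ℕ => qcoefSeq d (Lam d) (d:ℝ) r n) atTop =
          (⨅ m ∈ Set.Ici (1:ℕ), qcoefSeq d (Lam d) (d:ℝ) r m) ∧
      liminf (fun n : ℕ => qcoefSeq d (Lam d) (d:ℝ) r n) atTop =
          (⨅ m ∈ Set.Ici (1:ℕ), qcoefSeq d (Lam d) (d:ℝ) r m) ∧
      0 < limsup (fun n : ℕ => qcoefSeq d (Lam d) (d:ℝ) r n) atTop ∧
      limsup (fun n : ℕ => qcoefSeq d (Lam d) (d:ℝ) r n) atTop ≠ ⊤) := by
  have hlim := tendsto_qcoefSeq hd r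
  have hpos := iInf_qcoefSeq_pos_iff hd r
  have htop : (⨅ m ∈ Set.Ici (1 : ℕ), qcoefSeq d (Lam d) d r m) ≠ ⊤ :=
    ne_top_of_le_ne_top ENNReal.ofReal_ne_top (iInf₂_le 1 (by simp))
  refine ⟨⟨_, hlim, htop, hpos⟩, fun hr => ⟨hlim.limsup_eq, hlim.liminf_eq, ?_, ?_⟩⟩
  · rw [hlim.limsup_eq]
    exact hpos.2 hr.1
  · rw [hlim.limsup_eq]
    exact htop
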